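/- For every integer N ≥ 2, every global minimizer (f1, g1, l1, m1, c_fl, c_mg, c_ba, t) of the forward lower-bound problem satisfies f1 = 0 and g1 = 0. -/

import Mathlib

/-- The objective `G` of the lower-bound problems:
`G = √((c_fl² + c_mg² + N·c_ba²)/2) + (N−1)·√((f1−m1)² + (g1−l1)² + 4t)`. -/
noncomputable def Gobj (N : ℕ) (f1 g1 l1 m1 cfl cmg cba t : ℝ) : ℝ :=
  Real.sqrt ((cfl ^ 2 + cmg ^ 2 + N * cba ^ 2) / 2) +
    ((N : ℝ) - 1) * Real.sqrt ((f1 - m1) ^ 2 + (g1 - l1) ^ 2 + 4 * t)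

/-- Feasible set of the forward lower-bound problem. -/
def FeasFwdLB (N : ℕ) (f1 g1 l1 m1 cfl cmg cba t : ℝ) : Prop :=
  1 ≤ l1 ∧
  ((N : ℝ) - 1) * f1 + cfl + N * cba + N ≤ ((N : ℝ) - 1) * l1 ∧
  -f1 + cfl + N * cba + N ≤ ((N : ℝ) - 1) * l1 ∧
  f1 * m1 ≤ t ∧
  g1 * l1 ≤ t

/-- The quantity under the second square root of `Gobj` is at least `l ^ 2`, with equality only
if `f = 0` and `g = 0`. -/
lemma eq_zero_of_cost_le_sq {f g l m t : ℝ} (hl : 0 < l) (hfm : f * m ≤ t) (hgl : g * l ≤ t)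
    (h : (f - m) ^ 2 + (g - l) ^ 2 + 4 * t ≤ l ^ 2) : f = 0 ∧ g = 0 := by
  have hg : g = 0 := by
    rcases lt_trichotomy g 0 with hg | hg | hg
    · nlinarith [sq_nonneg (f + m), mul_pos (neg_pos.2 hg) hl, sq_nonneg g]
    · exact hg
    · nlinarith [sq_nonneg (f - m), mul_pos hg hl, sq_nonneg g]
  subst hg
  have hf : f ^ 2 = 0 := by nlinarith [sq_nonneg f, sq_nonneg m]
  exact ⟨pow_eq_zero_iff two_ne_zero |>.1 hf, rfl⟩

/-- Every global minimizer of the forward lower-bound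
problem satisfies `f1 = 0` and `g1 = 0`. -/
theorem forward_lower_bound_minimizer (N : ℕ) (hN : 2 ≤ N)
    (f1 g1 l1 m1 cfl cmg cba t : ℝ)
    (hfeas : FeasFwdLB N f1 g1 l1 m1 cfl cmg cba t)
    (hmin : ∀ f1' g1' l1' m1' cfl' cmg' cba' t' : ℝ,
      FeasFwdLB N f1' g1' l1' m1' cfl' cmg' cba' t' →
      Gobj N f1 g1 l1 m1 cfl cmg cba t ≤ Gobj N f1' g1' l1' m1' cfl' cmg' cba' t') :
    f1 = 0 ∧ g1 = 0 := by
  obtain ⟨hl, h1, h2, hfm, hgl⟩ := hfeas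
  have hN' : (2 : ℝ) ≤ N := by exact_mod_cast hN
  have hfeas₀ : FeasFwdLB N 0 0 l1 0 cfl cmg cba 0 := by
    refine ⟨hl, ?_, ?_, by simp, by simp⟩ <;>
    · rcases le_total 0 f1 with hf | hf
      · nlinarith [mul_nonneg (show (0 : ℝ) ≤ N - 1 by linarith) hf]
      · linarith
  have h := hmin _ _ _ _ _ _ _ _ hfeas₀
  unfold Gobj at h
  have hsqrt := le_of_mul_le_mul_left (le_of_add_le_add_left h)
    (show (0 : ℝ) < N - 1 by linarith)
  rw [Real.sqrt_le_sqrt_iff (by positivity)] at hsqrt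
  exact eq_zero_of_cost_le_sq (by linarith) hfm hgl (by linarith)
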